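/- arXiv:2507.15017 — 4 statements merged into one kernel-verified Lean document; each statement's English description precedes it below -/
import Mathlib

section
/- (Soundness of Algorithm FloatInvGen-A.) Let B : L → Set V be an assertion map, and for each transition t ∈ T let γ t : ι → ℝ satisfy: for every v ∈ B (src t), every r ∈ E t, and every i : ι, |F t v r i − F t v 0 i| ≤ γ t i (where 0 denotes the zero error valuation). Suppose an assertion map I : L → Set V satisfies: (i) initiation: Init ⊆ I ℓ*; (ii) the relaxed consecution condition for every transition t ∈ T: for every v ∈ I (src t) ∩ B (src t) ∩ G t and every v' : V with |v' i − F t v 0 i| ≤ γ t i for all i, one has v' ∈ I (tgt t); and (iii) entailment: I ℓ ⊆ B ℓ for every location ℓ. Then I is an invariant: for every path (ℓ₀,v₀),…,(ℓₙ,vₙ) and every index 0 ≤ j ≤ n, vⱼ ∈ I ℓⱼ. -/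
/-- Soundness of Algorithm FloatInvGen-A. -/
theorem floatInvGenA_sound
    {L ι ρ T : Type*}
    (linit : L)
    (src : T → L) (G : T → Set (ι → ℝ)) (E : T → Set (ρ → ℝ))
    (F : T → (ι → ℝ) → (ρ → ℝ) → (ι → ℝ)) (tgt : T → L)
    (Trans : Set T) (Init : Set (ι → ℝ))
    (B : L → Set (ι → ℝ)) (γ : T → ι → ℝ)
    (hγ : ∀ t ∈ Trans, ∀ v ∈ B (src t), ∀ r ∈ E t, ∀ i : ι,
      |F t v r i - F t v 0 i| ≤ γ t i)
    (I : L → Set (ι → ℝ))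
    (hinit : Init ⊆ I linit)
    (hrelax : ∀ t ∈ Trans, ∀ v ∈ I (src t) ∩ B (src t) ∩ G t, ∀ v' : ι → ℝ,
      (∀ i : ι, |v' i - F t v 0 i| ≤ γ t i) → v' ∈ I (tgt t))
    (hentail : ∀ ℓ' : L, I ℓ' ⊆ B ℓ')
    (n : ℕ) (ℓ : ℕ → L) (v : ℕ → ι → ℝ)
    (hstart : ℓ 0 = linit) (hv0 : v 0 ∈ Init)
    (hstep : ∀ j < n, ∃ t ∈ Trans, src t = ℓ j ∧ tgt t = ℓ (j + 1) ∧
      v j ∈ G t ∧ ∃ r ∈ E t, v (j + 1) = F t (v j) r) :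
    ∀ j ≤ n, v j ∈ I (ℓ j) := by
  intro j
  induction j with
  | zero =>
    intro _
    rw [hstart]
    exact hinit hv0
  | succ k ih =>
    intro hk
    have hI := ih (by omega)
    obtain ⟨t, ht, hs, htg, hG, r, hr, hv⟩ := hstep k (by omega)
    rw [← hs] at hI
    rw [← htg, hv]
    exact hrelax t ht (v k) ⟨⟨hI, hentail _ hI⟩, hG⟩ _ (hγ t ht (v k) (hentail _ hI) r hr)
end

section
/- (Soundness of Algorithm FloatInvGen-B.) For each transition t ∈ T let γ t : V → ι → ℝ be a state-dependent error-bound function satisfying: for every v : V, every r ∈ E t, and every i : ι, |F t v r i − F t v 0 i| ≤ γ t v i (where 0 denotes the zero error valuation). Suppose an assertion map I : L → Set V satisfies: (i) initiation: Init ⊆ I ℓ*; and (ii) the relaxed consecution condition for every transition t ∈ T: for every v ∈ I (src t) ∩ G t and every v' : V with |v' i − F t v 0 i| ≤ γ t v i for all i, one has v' ∈ I (tgt t). Then I is an invariant: for every path (ℓ₀,v₀),…,(ℓₙ,vₙ) and every index 0 ≤ j ≤ n, vⱼ ∈ I ℓⱼ. -/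
/-- Soundness of Algorithm FloatInvGen-B. -/
theorem floatInvGenB_sound
    {L ι ρ T : Type*}
    (linit : L)
    (src : T → L) (G : T → Set (ι → ℝ)) (E : T → Set (ρ → ℝ))
    (F : T → (ι → ℝ) → (ρ → ℝ) → (ι → ℝ)) (tgt : T → L)
    (Trans : Set T) (Init : Set (ι → ℝ))
    (γ : T → (ι → ℝ) → ι → ℝ)
    (hγ : ∀ t ∈ Trans, ∀ v : ι → ℝ, ∀ r ∈ E t, ∀ i : ι,
      |F t v r i - F t v 0 i| ≤ γ t v i)
    (I : L → Set (ι → ℝ))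
    (hinit : Init ⊆ I linit)
    (hrelax : ∀ t ∈ Trans, ∀ v ∈ I (src t) ∩ G t, ∀ v' : ι → ℝ,
      (∀ i : ι, |v' i - F t v 0 i| ≤ γ t v i) → v' ∈ I (tgt t))
    (n : ℕ) (ℓ : ℕ → L) (v : ℕ → ι → ℝ)
    (hstart : ℓ 0 = linit) (hv0 : v 0 ∈ Init)
    (hstep : ∀ j < n, ∃ t ∈ Trans, src t = ℓ j ∧ tgt t = ℓ (j + 1) ∧
      v j ∈ G t ∧ ∃ r ∈ E t, v (j + 1) = F t (v j) r) :
    ∀ j ≤ n, v j ∈ I (ℓ j) := by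
  intro j
  induction j with
  | zero =>
    intro _
    rw [hstart]
    exact hinit hv0
  | succ k ih =>
    intro hk
    obtain ⟨t, ht, hs, hg, hG, r, hr, hv⟩ := hstep k (by omega)
    have hI : v k ∈ I (src t) := by
      rw [hs]
      exact ih (by omega)
    rw [← hg, hv]
    exact hrelax t ht (v k) ⟨hI, hG⟩ _ (hγ t ht (v k) r hr)
end

section
/- (Handelman cone shift lemma.) Let σ be a type, m : ℕ, Θ a set of polynomials in MvPolynomial σ ℝ, q ∈ MvPolynomial σ ℝ, and c : ℝ with c ≥ 0. Then Cone_m(Θ ∪ {q + C c}) ⊆ Cone_m(Θ ∪ {q}); that is, every polynomial expressible as a nonnegative combination of products of at most m elements of Θ ∪ {q + C c} is also so expressible over Θ ∪ {q}. -/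
open MvPolynomial

/-- The Handelman cone of degree `m` over a set `Θ` of polynomials: all finite
nonnegative combinations of products of at most `m` elements of `Θ`. -/
def HandelmanCone {σ : Type*} (m : ℕ) (Θ : Set (MvPolynomial σ ℝ)) :
    Set (MvPolynomial σ ℝ) :=
  {p | ∃ (k : ℕ) (lam : Fin k → ℝ) (g : Fin k → Multiset (MvPolynomial σ ℝ)),
    (∀ j, 0 ≤ lam j) ∧
    (∀ j, (g j).card ≤ m ∧ ∀ q ∈ g j, q ∈ Θ) ∧
    p = ∑ j, MvPolynomial.C (lam j) * (g j).prod}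

theorem hc_zero {σ : Type*} (m : ℕ) (Θ : Set (MvPolynomial σ ℝ)) :
    (0 : MvPolynomial σ ℝ) ∈ HandelmanCone m Θ :=
  ⟨0, fun _ => 0, fun _ => 0, by simp, by simp, by simp⟩

theorem hc_add {σ : Type*} {m : ℕ} {Θ : Set (MvPolynomial σ ℝ)} {p r : MvPolynomial σ ℝ}
    (hp : p ∈ HandelmanCone m Θ) (hr : r ∈ HandelmanCone m Θ) :
    p + r ∈ HandelmanCone m Θ := by
  obtain ⟨k, l, g, h1, h2, rfl⟩ := hp
  obtain ⟨k', l', g', h1', h2', rfl⟩ := hr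
  refine ⟨k + k', Fin.append l l', Fin.append g g', ?_, ?_, ?_⟩
  · intro j
    refine Fin.addCases (fun i => ?_) (fun i => ?_) j
    · simpa using h1 i
    · simpa using h1' i
  · intro j
    refine Fin.addCases (fun i => ?_) (fun i => ?_) j
    · rw [Fin.append_left]; exact h2 i
    · rw [Fin.append_right]; exact h2' i
  · simp [Fin.sum_univ_add]

theorem hc_smul {σ : Type*} {m : ℕ} {Θ : Set (MvPolynomial σ ℝ)} {p : MvPolynomial σ ℝ}
    {c : ℝ} (hc : 0 ≤ c) (hp : p ∈ HandelmanCone m Θ) :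
    MvPolynomial.C c * p ∈ HandelmanCone m Θ := by
  obtain ⟨k, l, g, h1, h2, rfl⟩ := hp
  exact ⟨k, fun j => c * l j, g, fun j => mul_nonneg hc (h1 j), h2, by
    simp [Finset.mul_sum, mul_assoc]⟩

theorem hc_mono {σ : Type*} {m n : ℕ} (h : m ≤ n) {Θ : Set (MvPolynomial σ ℝ)}
    {p : MvPolynomial σ ℝ} (hp : p ∈ HandelmanCone m Θ) : p ∈ HandelmanCone n Θ := by
  obtain ⟨k, l, g, h1, h2, rfl⟩ := hp
  exact ⟨k, l, g, h1, fun j => ⟨(h2 j).1.trans h, (h2 j).2⟩, rfl⟩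

theorem hc_mul {σ : Type*} {m : ℕ} {Θ : Set (MvPolynomial σ ℝ)} {p t : MvPolynomial σ ℝ}
    (ht : t ∈ Θ) (hp : p ∈ HandelmanCone m Θ) : t * p ∈ HandelmanCone (m + 1) Θ := by
  obtain ⟨k, l, g, h1, h2, rfl⟩ := hp
  refine ⟨k, l, fun j => t ::ₘ g j, h1, fun j => ⟨?_, ?_⟩, ?_⟩
  · simpa using (h2 j).1
  · intro x hx
    rcases Multiset.mem_cons.1 hx with rfl | hx
    · exact ht
    · exact (h2 j).2 x hx
  · simp [Finset.mul_sum, mul_left_comm]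

theorem hc_prod {σ : Type*} (Θ : Set (MvPolynomial σ ℝ))
    (q : MvPolynomial σ ℝ) (c : ℝ) (hc : 0 ≤ c) (s : Multiset (MvPolynomial σ ℝ)) :
    (∀ x ∈ s, x ∈ Θ ∪ {q + MvPolynomial.C c}) →
      s.prod ∈ HandelmanCone s.card (Θ ∪ {q}) := by
  induction s using Multiset.induction_on with
  | empty => exact fun _ => ⟨1, fun _ => 1, fun _ => 0, by simp, by simp, by simp⟩
  | cons a s ih =>
    intro h
    have hs := ih fun x hx => h x (Multiset.mem_cons_of_mem hx)
    rw [Multiset.prod_cons, Multiset.card_cons]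
    rcases h a (Multiset.mem_cons_self a s) with ha | ha
    · exact hc_mul (Or.inl ha) hs
    · rw [Set.mem_singleton_iff.1 ha, add_mul]
      exact hc_add (hc_mul (Or.inr rfl) hs) (hc_mono (Nat.le_succ _) (hc_smul hc hs))

/-- Handelman cone shift lemma. -/
theorem handelmanCone_shift {σ : Type*} (m : ℕ) (Θ : Set (MvPolynomial σ ℝ))
    (q : MvPolynomial σ ℝ) (c : ℝ) (hc : c ≥ 0) :
    HandelmanCone m (Θ ∪ {q + MvPolynomial.C c}) ⊆ HandelmanCone m (Θ ∪ {q}) := by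
  rintro p ⟨k, l, g, h1, h2, rfl⟩
  exact Finset.sum_induction _ (· ∈ HandelmanCone m (Θ ∪ {q})) (fun _ _ => hc_add)
    (hc_zero _ _) fun j _ =>
      hc_smul (h1 j) (hc_mono (h2 j).1 (hc_prod Θ q c hc _ (h2 j).2))
end

section
/- (First-order differential characterization bound for absolute rounding errors.) Let k : ℕ and let g : (Fin k → ℝ) → ℝ be twice continuously differentiable (ContDiff ℝ 2 g). Let ε : Fin k → ℝ with ε i ≥ 0 for all i, and let r : Fin k → ℝ satisfy |r i| ≤ ε i for all i. Then there exists r' : Fin k → ℝ with |r' i| ≤ ε i for all i such that |g r − g 0| ≤ Σᵢ |(fderiv ℝ g 0) (Pi.single i 1)| * ε i + (1/2) * |(iteratedFDeriv ℝ 2 g r') (fun _ => r)|, i.e., the deviation of g at the error valuation r from its value at zero errors is bounded by the sum of the absolute partial derivatives at zero times the per-operation error bounds, plus the absolute value of the second-order Taylor remainder evaluated at an intermediate point in the error box. -/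
/-- First-order differential characterization bound for absolute rounding errors. -/
theorem fo_dc_bound (k : ℕ) (g : (Fin k → ℝ) → ℝ) (hg : ContDiff ℝ 2 g)
    (ε : Fin k → ℝ) (hε : ∀ i, ε i ≥ 0)
    (r : Fin k → ℝ) (hr : ∀ i, |r i| ≤ ε i) :
    ∃ r' : Fin k → ℝ, (∀ i, |r' i| ≤ ε i) ∧
      |g r - g 0| ≤ (∑ i, |(fderiv ℝ g 0) (Pi.single i 1)| * ε i) +
        (1 / 2) * |(iteratedFDeriv ℝ 2 g r') (fun _ => r)| := by
  have hl : ∀ t : ℝ, HasDerivAt (fun t : ℝ => t • r) r t := fun t => by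
    simpa using (hasDerivAt_id t).smul_const r
  have hgd : Differentiable ℝ g := hg.differentiable (by norm_num)
  have hg' : Differentiable ℝ (fderiv ℝ g) :=
    (hg.fderiv_right (m := 1) (by norm_num)).differentiable (by norm_num)
  have h1 : ∀ t : ℝ, HasDerivAt (fun t : ℝ => g (t • r)) (fderiv ℝ g (t • r) r) t :=
    fun t => (hgd (t • r)).hasFDerivAt.comp_hasDerivAt t (hl t)
  have h2 : ∀ t : ℝ, HasDerivAt (fun t : ℝ => fderiv ℝ g (t • r) r)
      (fderiv ℝ (fderiv ℝ g) (t • r) r r) t := fun t => by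
    have := (hg' (t • r)).hasFDerivAt.comp_hasDerivAt t (hl t)
    simpa using this.clm_apply (hasDerivAt_const t r)
  have d1 : deriv (fun t : ℝ => g (t • r)) = fun t : ℝ => fderiv ℝ g (t • r) r :=
    funext fun t => (h1 t).deriv
  have hc : ContDiff ℝ 2 (fun t : ℝ => g (t • r)) :=
    hg.comp (contDiff_id.smul contDiff_const)
  obtain ⟨t, ht, h⟩ := taylor_mean_remainder_lagrange_iteratedDeriv (n := 1) (x₀ := 0) (x := 1)
    (f := fun t : ℝ => g (t • r)) (by norm_num) (by norm_num; exact hc.contDiffOn)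
  rw [Set.uIoo_of_lt one_pos] at ht
  have e2 : iteratedDeriv (1 + 1) (fun t : ℝ => g (t • r)) t
      = iteratedFDeriv ℝ 2 g (t • r) (fun _ => r) := by
    rw [iteratedDeriv_succ, iteratedDeriv_one, d1, (h2 t).deriv, iteratedFDeriv_two_apply]
  have e1 : derivWithin (fun t : ℝ => g (t • r)) (Set.uIcc 0 1) 0 = fderiv ℝ g 0 r := by
    rw [(h1 0).hasDerivWithinAt.derivWithin (uniqueDiffOn_uIcc (by norm_num) 0 (by simp))]
    simp
  rw [e2, taylorWithinEval_succ, taylor_within_zero_eval, iteratedDerivWithin_one, e1] at h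
  have e3 : fderiv ℝ g 0 r = ∑ i, r i * fderiv ℝ g 0 (Pi.single i 1) := by
    conv_lhs => rw [pi_eq_sum_univ' r]
    simp [Pi.single_apply, map_sum, Pi.single, Function.update, funext_iff]
  have e4 : |fderiv ℝ g 0 r| ≤ ∑ i, |(fderiv ℝ g 0) (Pi.single i 1)| * ε i := by
    rw [e3]
    refine (Finset.abs_sum_le_sum_abs _ _).trans (Finset.sum_le_sum fun i _ => ?_)
    rw [abs_mul, mul_comm]
    exact mul_le_mul_of_nonneg_left (hr i) (abs_nonneg _)
  refine ⟨t • r, fun i => ?_, ?_⟩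
  · rw [Pi.smul_apply, smul_eq_mul, abs_mul, abs_of_pos ht.1]
    exact (mul_le_of_le_one_left (abs_nonneg _) ht.2.le).trans (hr i)
  · norm_num at h
    have : g r - g 0 = fderiv ℝ g 0 r + (1/2) * (iteratedFDeriv ℝ 2 g (t • r)) (fun _ => r) := by
      linarith
    rw [this]
    refine (abs_add_le _ _).trans ?_
    rw [abs_mul, abs_of_pos (by norm_num : (0:ℝ) < 1/2)]
    linarith
end
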